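/- Let n be a positive integer and Γ : (0,1) → (0,1) a function with Γ(ε) < ε for all ε. Let Y be a real Banach space and {Y_α : α ∈ Λ} a family of linear subspaces of Y that is totally ordered by inclusion (nested) and such that Y is the closure of ⋃_{α∈Λ} Y_α. Assume that each subspace Y_α (with the norm induced from Y) has the approximate hyperplane sum property for ℓ∞ⁿ with the function Γ. Then Y has the approximate hyperplane sum property for ℓ∞ⁿ with the function γ(ε) = Γ(ε/2). -/

import Mathlib

open scoped BigOperators

noncomputable section

def vvec (n : ℕ) (i : Fin n) : Fin n → ℝ :=
  fun j => if 0 < (j : ℕ) ∧ (j : ℕ) ≤ (i : ℕ) then -1 else 1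

def MSet (Y : Type*) [NormedAddCommGroup Y] [NormedSpace ℝ Y] (n : ℕ) :
    Set (Fin n → Y) :=
  {y | ∀ k : ℕ, Odd k → k ≤ n → ∀ c : Fin k → Fin n, StrictMono c →
    ‖∑ j : Fin k, ((-1 : ℝ) ^ (j : ℕ)) • y (c j)‖ ≤ 1}

def AHSpWith (Y : Type*) [NormedAddCommGroup Y] [NormedSpace ℝ Y] (n : ℕ)
    (γ : ℝ → ℝ) : Prop :=
  ∀ ε : ℝ, 0 < ε → ε < 1 →
    (0 < γ ε ∧ γ ε < ε) ∧
    ∀ y ∈ MSet Y n, ∀ A : Finset (Fin n), A.Nonempty →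
      ∀ f : Y →L[ℝ] ℝ, ‖f‖ = 1 → (∀ i ∈ A, 1 - γ ε < f (y i)) →
        ∃ z ∈ MSet Y n, (∀ i, ‖z i - y i‖ < ε) ∧ ‖∑ i ∈ A, z i‖ = (A.card : ℝ)

def AHSp (Y : Type*) [NormedAddCommGroup Y] [NormedSpace ℝ Y] (n : ℕ) : Prop :=
  ∀ ε : ℝ, 0 < ε → ε < 1 → ∃ γ : ℝ, 0 < γ ∧ γ < ε ∧
    ∀ y ∈ MSet Y n, ∀ A : Finset (Fin n), A.Nonempty →
      ∀ f : Y →L[ℝ] ℝ, ‖f‖ = 1 → (∀ i ∈ A, 1 - γ < f (y i)) →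
        ∃ z ∈ MSet Y n, (∀ i, ‖z i - y i‖ < ε) ∧ ‖∑ i ∈ A, z i‖ = (A.card : ℝ)

def BPBpWith (X Y : Type*) [NormedAddCommGroup X] [NormedSpace ℝ X]
    [NormedAddCommGroup Y] [NormedSpace ℝ Y] (η : ℝ → ℝ) : Prop :=
  ∀ ε : ℝ, 0 < ε → ε < 1 →
    (0 < η ε ∧ η ε < ε) ∧
    ∀ T : X →L[ℝ] Y, ‖T‖ = 1 → ∀ x₀ : X, ‖x₀‖ = 1 → 1 - η ε < ‖T x₀‖ →
      ∃ S : X →L[ℝ] Y, ‖S‖ = 1 ∧ ∃ u₀ : X, ‖u₀‖ = 1 ∧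
        ‖S u₀‖ = 1 ∧ ‖u₀ - x₀‖ < ε ∧ ‖S - T‖ < ε

def IsOneNorming {Y : Type*} [NormedAddCommGroup Y] [NormedSpace ℝ Y]
    (B : Set (Y →L[ℝ] ℝ)) : Prop :=
  (∀ f ∈ B, ‖f‖ = 1) ∧ ∀ y : Y, ‖y‖ = sSup ((fun f : Y →L[ℝ] ℝ => |f y|) '' B)

def tauMap (Y : Type*) [Neg Y] (n : ℕ) (y : Fin n → Y) : Fin n → Y :=
  fun i => if h : (i : ℕ) + 1 < n then y ⟨(i : ℕ) + 1, h⟩ else -y ⟨0, i.pos⟩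

def ustar (x : lp (fun _ : ℕ => ℝ) 1) : ℝ := ∑' k, x k

/-- Every entry of a tuple in `MSet Y n` lies in the closed unit ball. -/
theorem norm_le_one_of_mem_MSet {Y : Type*} [NormedAddCommGroup Y] [NormedSpace ℝ Y] {n : ℕ}
    {y : Fin n → Y} (hy : y ∈ MSet Y n) (i : Fin n) : ‖y i‖ ≤ 1 := by
  have h := hy 1 odd_one (by have := i.pos; omega) (fun _ => i) (Subsingleton.strictMono _)
  simpa using h

/-- Finitely many points can be approximated simultaneously from one member of a nested family of
subspaces with dense union. -/
theorem exists_common_approx {Y Λ ι : Type*} [NormedAddCommGroup Y] [NormedSpace ℝ Y]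
    [Finite ι] [Nonempty ι] (Ysub : Λ → Submodule ℝ Y)
    (hnested : ∀ a b : Λ, Ysub a ≤ Ysub b ∨ Ysub b ≤ Ysub a)
    (hdense : closure (⋃ a, (Ysub a : Set Y)) = Set.univ) (y : ι → Y) {δ : ℝ} (hδ : 0 < δ) :
    ∃ a, ∃ x : ι → Ysub a, ∀ i, ‖(x i : Y) - y i‖ < δ := by
  have h : ∀ i, ∃ a, ∃ x ∈ Ysub a, ‖x - y i‖ < δ := by
    intro i
    have hi : y i ∈ closure (⋃ a, (Ysub a : Set Y)) := hdense ▸ Set.mem_univ _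
    obtain ⟨x, hx, hxy⟩ := Metric.mem_closure_iff.1 hi δ hδ
    obtain ⟨a, ha⟩ := Set.mem_iUnion.1 hx
    exact ⟨a, x, ha, by rwa [← dist_eq_norm, dist_comm]⟩
  choose b x hx hxy using h
  have : Nonempty Λ := ⟨b (Classical.arbitrary ι)⟩
  have hdir : Directed (· ≤ ·) Ysub := fun a c =>
    (hnested a c).elim (fun h => ⟨c, h, le_rfl⟩) (fun h => ⟨a, le_rfl, h⟩)
  obtain ⟨a, ha⟩ := hdir.finite_le b
  exact ⟨a, fun i => ⟨x i, ha i (hx i)⟩, hxy⟩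

/-- Tuples uniformly close to a member of `MSet Y n` enter `MSet Y n` after a slight shrinking. -/
theorem smul_mem_MSet_of_close {Y : Type*} [NormedAddCommGroup Y] [NormedSpace ℝ Y] {n : ℕ}
    {y x : Fin n → Y} (hy : y ∈ MSet Y n) {δ : ℝ} (hδ : 0 ≤ δ) (hxy : ∀ i, ‖x i - y i‖ ≤ δ) :
    (fun i => (1 + n * δ)⁻¹ • x i) ∈ MSet Y n := by
  intro k hk hkn c hc
  have hpos : 0 < 1 + n * δ := by positivity
  have hdiff : ‖∑ j : Fin k, ((-1 : ℝ) ^ (j : ℕ)) • (x (c j) - y (c j))‖ ≤ n * δ := by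
    refine (norm_sum_le_of_le (n := fun _ => δ) Finset.univ fun j _ => ?_).trans ?_
    · simpa [norm_smul] using hxy (c j)
    · simp only [Finset.sum_const, Finset.card_univ, Fintype.card_fin, nsmul_eq_mul]
      gcongr
  have hsum : ‖∑ j : Fin k, ((-1 : ℝ) ^ (j : ℕ)) • x (c j)‖ ≤ 1 + n * δ := by
    have hsplit : ∑ j : Fin k, ((-1 : ℝ) ^ (j : ℕ)) • x (c j) =
        ∑ j : Fin k, ((-1 : ℝ) ^ (j : ℕ)) • y (c j) +
          ∑ j : Fin k, ((-1 : ℝ) ^ (j : ℕ)) • (x (c j) - y (c j)) := by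
      rw [← Finset.sum_add_distrib]
      simp [← smul_add]
    rw [hsplit]
    exact norm_add_le_of_le (hy k hk hkn c hc) hdiff
  simp_rw [smul_comm _ (1 + n * δ)⁻¹, ← Finset.smul_sum]
  rw [norm_smul, norm_inv, Real.norm_of_nonneg hpos.le]
  exact inv_mul_le_one_of_le₀ hsum hpos.le

/-- The shrinking factor `(1 + n * δ)⁻¹` moves points close to the unit ball by at most
`(n + 1) * δ`. -/
theorem norm_inv_smul_sub_le {Y : Type*} [NormedAddCommGroup Y] [NormedSpace ℝ Y] (n : ℕ)
    {x y : Y} (hy : ‖y‖ ≤ 1) {δ : ℝ} (hδ : 0 ≤ δ) (hxy : ‖x - y‖ ≤ δ) :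
    ‖(1 + n * δ)⁻¹ • x - y‖ ≤ (n + 1) * δ := by
  have hpos : 0 < 1 + n * δ := by positivity
  have hrw : (1 + n * δ)⁻¹ • x - y = (1 + n * δ)⁻¹ • ((x - y) - (n * δ) • y) := by
    have h : y = (1 + n * δ)⁻¹ • (1 + n * δ) • y := (inv_smul_smul₀ hpos.ne' y).symm
    conv_lhs => rw [h]
    rw [← smul_sub]
    congr 1
    module
  have hsmul : ‖(n * δ) • y‖ ≤ n * δ := by
    rw [norm_smul, Real.norm_of_nonneg (by positivity)]
    exact mul_le_of_le_one_right (by positivity) hy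
  have hle : (1 + n * δ)⁻¹ ≤ 1 := inv_le_one_of_one_le₀ (by nlinarith [mul_nonneg n.cast_nonneg hδ])
  rw [hrw, norm_smul, norm_inv, Real.norm_of_nonneg hpos.le]
  calc (1 + n * δ)⁻¹ * ‖(x - y) - (n * δ) • y‖ ≤ 1 * (δ + n * δ) := by
        gcongr
        exact norm_sub_le_of_le hxy hsmul
    _ = (n + 1) * δ := by ring

/-- Membership in `MSet` does not depend on the ambient space. -/
theorem coe_mem_MSet_iff {Y : Type*} [NormedAddCommGroup Y] [NormedSpace ℝ Y] {n : ℕ}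
    {S : Submodule ℝ Y} {x : Fin n → S} :
    (fun i => (x i : Y)) ∈ MSet Y n ↔ x ∈ MSet S n := by
  simp only [MSet, Set.mem_ofPred_eq, ← Submodule.coe_norm, ← Submodule.coe_smul,
    ← Submodule.coe_sum]

/-- Proposition 4.4: if `Y` is the closure of the union of a nested family of
subspaces each having the AHSp-ℓ∞ⁿ with a common function `Γ`, then `Y` has the AHSp-ℓ∞ⁿ
with the function `γ(ε) = Γ(ε/2)`. -/
theorem stmt19 (n : ℕ) (hn : 0 < n) (Γ : ℝ → ℝ)
    (hΓ : ∀ ε : ℝ, 0 < ε → ε < 1 → 0 < Γ ε ∧ Γ ε < ε)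
    (Y : Type*) [NormedAddCommGroup Y] [NormedSpace ℝ Y] [CompleteSpace Y]
    (Λ : Type*) (Ysub : Λ → Submodule ℝ Y)
    (hnested : ∀ a b : Λ, Ysub a ≤ Ysub b ∨ Ysub b ≤ Ysub a)
    (hdense : closure (⋃ a, (Ysub a : Set Y)) = Set.univ)
    (hAHSp : ∀ a, AHSpWith (Ysub a) n Γ) :
    AHSpWith Y n (fun ε => Γ (ε / 2)) := by
  intro ε hε hε1
  obtain ⟨hΓpos, hΓlt⟩ := hΓ (ε / 2) (by linarith) (by linarith)
  refine ⟨⟨hΓpos, by linarith⟩, ?_⟩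
  intro y hy A hA f hf hfy
  have : Nonempty (Fin n) := ⟨⟨0, hn⟩⟩
  obtain ⟨i₀, hi₀, hmin⟩ := A.exists_min_image (fun i => f (y i)) hA
  have hi₀f := hfy i₀ hi₀
  obtain ⟨η, hη, hηε, hηf⟩ : ∃ η > 0, η < ε / 2 ∧ η < f (y i₀) - (1 - Γ (ε / 2)) := by
    obtain ⟨η, hη, h⟩ := exists_between
      (lt_min (show (0 : ℝ) < ε / 2 by linarith) (sub_pos.2 hi₀f))
    exact ⟨η, hη, lt_min_iff.1 h⟩
  set δ : ℝ := η / (n + 1) with hδdef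
  have hδ : 0 < δ := by positivity
  have hδη : (n + 1) * δ = η := by rw [hδdef]; field_simp
  obtain ⟨a, x', hx'⟩ := exists_common_approx Ysub hnested hdense y hδ
  set x : Fin n → Ysub a := fun i => (1 + n * δ)⁻¹ • x' i with hx
  have hxM : x ∈ MSet (Ysub a) n :=
    coe_mem_MSet_iff.1 (smul_mem_MSet_of_close hy hδ.le fun i => (hx' i).le)
  have hxy : ∀ i, ‖(x i : Y) - y i‖ ≤ η := fun i =>
    hδη ▸ norm_inv_smul_sub_le n (norm_le_one_of_mem_MSet hy i) hδ.le (hx' i).le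
  have hfx : ∀ i ∈ A, 1 - Γ (ε / 2) < f (x i) := by
    intro i hi
    have h₁ := (f.le_opNorm ((x i : Y) - y i)).trans_eq (by rw [hf, one_mul])
    rw [map_sub, Real.norm_eq_abs] at h₁
    linarith [(abs_le.1 (h₁.trans (hxy i))).1, hmin i hi]
  obtain ⟨g, hg⟩ : ∃ g : Ysub a →L[ℝ] ℝ, ∀ v, g v = f v :=
    ⟨f.comp (Ysub a).subtypeL, fun _ => rfl⟩
  have hg1 : ‖g‖ ≤ 1 := by
    refine g.opNorm_le_bound zero_le_one fun v => ?_
    simpa [hf, hg] using f.le_opNorm (v : Y)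
  have hg0 : 0 < ‖g‖ := by
    have h₀ : 0 < ‖g‖ * ‖x i₀‖ := by
      have h₁ := (le_abs_self _).trans (g.le_opNorm (x i₀))
      rw [hg] at h₁
      linarith [hfx i₀ hi₀]
    exact pos_of_mul_pos_left h₀ (norm_nonneg _)
  obtain ⟨-, hprop⟩ := hAHSp a (ε / 2) (by linarith) (by linarith)
  obtain ⟨z, hz, hzx, hzA⟩ := hprop x hxM A hA (‖g‖⁻¹ • g)
    (by rw [norm_smul, norm_inv, Real.norm_of_nonneg hg0.le, inv_mul_cancel₀ hg0.ne'])
    (fun i hi => by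
      have h₁ := hfx i hi
      rw [← hg] at h₁
      refine h₁.trans_le ?_
      exact le_mul_of_one_le_left (by linarith) ((one_le_inv₀ hg0).2 hg1))
  refine ⟨fun i => z i, coe_mem_MSet_iff.2 hz, fun i => ?_, ?_⟩
  · have h₁ : ‖(z i : Y) - x i‖ < ε / 2 := hzx i
    linarith [norm_sub_le_norm_sub_add_norm_sub (z i : Y) (x i) (y i), hxy i]
  · rw [← hzA, Submodule.coe_norm, Submodule.coe_sum]
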